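/- Integral rigidity for the degenerate transport equation on the half-plane. Let 𝒟 = {(R,Z) ∈ ℝ² : R ≤ 0}, let γ > 0, and let p be a positive even integer. Let U, Ψ : 𝒟 → ℝ be C¹ up to the boundary, with U bounded. Suppose that on 𝒟: (γ Y + ∇^⊥Ψ)·∇U = 0, that ∂_Z Ψ(0,Z) = 0 for every Z ∈ ℝ, that |∇Ψ(Y)|/|Y| → 0 as |Y| → ∞ (Y ∈ 𝒟), and that ∫_{{Y ∈ 𝒟 : ρ < |Y| < 2ρ}} U(Y)^p dY → 0 as ρ → ∞. Then U ≡ 0 on 𝒟. -/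

import Mathlib

open MeasureTheory Filter

/-- Partial derivative in the first variable. -/
noncomputable def pd1 (f : ℝ → ℝ → ℝ) (x y : ℝ) : ℝ := deriv (fun s => f s y) x

/-- Partial derivative in the second variable. -/
noncomputable def pd2 (f : ℝ → ℝ → ℝ) (x y : ℝ) : ℝ := deriv (fun s => f x s) y

section
open MeasureTheory Filter Set Topology

noncomputable abbrev muH : Measure (ℝ × ℝ) := (volume.restrict (Iio (0:ℝ))).prod volume

lemma muH_eq : muH = (volume : Measure (ℝ × ℝ)).restrict (Iio 0 ×ˢ univ) := by
  have := Measure.prod_restrict (μ := (volume : Measure ℝ)) (ν := (volume : Measure ℝ))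
    (Iio (0:ℝ)) univ
  rw [Measure.restrict_univ] at this
  exact this

lemma muH_neg : ∀ᵐ q ∂muH, q.1 < 0 := by
  rw [muH_eq]
  filter_upwards [ae_restrict_mem (measurableSet_Iio.prod MeasurableSet.univ)] with q hq
  exact hq.1

lemma hcs_of_supp {f : ℝ × ℝ → ℝ} {L : ℝ} (hL : ∀ q, L < ‖q‖ → f q = 0) :
    HasCompactSupport f := by
  refine HasCompactSupport.intro (isCompact_closedBall (0 : ℝ × ℝ) L) ?_
  intro x hx
  apply hL
  simpa using hx

lemma int_of_supp {f : ℝ × ℝ → ℝ} (hf : Continuous f) {L : ℝ}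
    (hL : ∀ q, L < ‖q‖ → f q = 0) : Integrable f muH := by
  rw [muH_eq]
  exact (hf.integrable_of_hasCompactSupport (hcs_of_supp hL)).restrict

lemma norm_lt_of_fst {L : ℝ} {R Z : ℝ} (h : L < |R|) : L < ‖((R, Z) : ℝ × ℝ)‖ := by
  rw [Prod.norm_def]; exact lt_of_lt_of_le h (le_max_left _ _)

lemma norm_lt_of_snd {L : ℝ} {R Z : ℝ} (h : L < |Z|) : L < ‖((R, Z) : ℝ × ℝ)‖ := by
  rw [Prod.norm_def]; exact lt_of_lt_of_le h (le_max_right _ _)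

lemma int1_of_supp {f : ℝ → ℝ} (hf : Continuous f) {L : ℝ}
    (hL : ∀ x, L < |x| → f x = 0) : Integrable f := by
  refine hf.integrable_of_hasCompactSupport ?_
  refine HasCompactSupport.intro (isCompact_closedBall (0 : ℝ) L) ?_
  intro x hx
  apply hL
  simpa using hx

lemma R_div {f f1 : ℝ × ℝ → ℝ} (hf : Continuous f) (hf1 : Continuous f1) {L : ℝ}
    (hL : ∀ q, L < ‖q‖ → f q = 0) (hL1 : ∀ q, L < ‖q‖ → f1 q = 0)
    (hd : ∀ R < 0, ∀ Z, HasDerivAt (fun s => f (s, Z)) (f1 (R, Z)) R)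
    (h0 : ∀ Z, f (0, Z) = 0) : ∫ q, f1 q ∂muH = 0 := by
  rw [integral_prod_symm _ (int_of_supp hf1 hL1)]
  have : ∀ Z, ∫ R in Iio (0:ℝ), f1 (R, Z) = 0 := by
    intro Z
    rw [← integral_Iic_eq_integral_Iio]
    rw [integral_Iic_of_hasDerivAt_of_tendsto (f := fun s => f (s, Z)) (m := 0)]
    · simp [h0]
    · exact (by fun_prop : Continuous fun s => f (s, Z)).continuousWithinAt
    · intro x hx; exact hd x hx Z
    · exact (int1_of_supp (by fun_prop) (fun x hx => hL1 _ (norm_lt_of_fst hx))).integrableOn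
    · apply tendsto_const_nhds.congr'
      filter_upwards [eventually_lt_atBot (-|L|)] with x hx
      refine (hL _ (norm_lt_of_fst ?_)).symm
      have := le_abs_self L
      have := neg_abs_le x
      have := abs_nonneg L
      linarith
  simp [this]

lemma Z_div {f f2 : ℝ × ℝ → ℝ} (hf : Continuous f) (hf2 : Continuous f2) {L : ℝ}
    (hL : ∀ q, L < ‖q‖ → f q = 0) (hL2 : ∀ q, L < ‖q‖ → f2 q = 0)
    (hd : ∀ R < 0, ∀ Z, HasDerivAt (fun s => f (R, s)) (f2 (R, Z)) Z) :
    ∫ q, f2 q ∂muH = 0 := by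
  rw [integral_prod _ (int_of_supp hf2 hL2)]
  rw [setIntegral_congr_fun (g := fun _ => (0:ℝ)) measurableSet_Iio]
  · simp
  · intro R hR
    exact integral_eq_zero_of_hasDerivAt_of_integrable (f := fun s => f (R, s))
      (fun x => hd R hR x)
      (int1_of_supp (by fun_prop) (fun x hx => hL2 _ (norm_lt_of_snd hx)))
      (int1_of_supp (by fun_prop) (fun x hx => hL _ (norm_lt_of_snd hx)))

/-- `f` is continuous with continuous partial derivatives on the open half-plane. -/
structure Good (f f1 f2 : ℝ × ℝ → ℝ) : Prop where
  c : Continuous f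
  c1 : Continuous f1
  c2 : Continuous f2
  d1 : ∀ R < 0, ∀ Z, HasDerivAt (fun s => f (s, Z)) (f1 (R, Z)) R
  d2 : ∀ R < 0, ∀ Z, HasDerivAt (fun s => f (R, s)) (f2 (R, Z)) Z

lemma euler {V V1 V2 : ℝ × ℝ → ℝ} (hV : Good V V1 V2) {L : ℝ}
    (hL : ∀ q, L < ‖q‖ → V q = 0) (hL1 : ∀ q, L < ‖q‖ → V1 q = 0)
    (hL2 : ∀ q, L < ‖q‖ → V2 q = 0) :
    ∫ q, (q.1 * V1 q + q.2 * V2 q + 2 * V q) ∂muH = 0 := by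
  have c := hV.c
  have c1 := hV.c1
  have c2 := hV.c2
  have A : ∫ q, (V q + q.1 * V1 q) ∂muH = 0 := by
    refine R_div (f := fun q => q.1 * V q) (L := L) (by fun_prop) (by fun_prop) ?_ ?_ ?_ ?_
    · intro q hq; simp [hL q hq]
    · intro q hq; simp [hL q hq, hL1 q hq]
    · intro R hR Z
      have := (hasDerivAt_id R).mul (hV.d1 R hR Z)
      rw [one_mul] at this
      exact this
    · simp
  have B : ∫ q, (V q + q.2 * V2 q) ∂muH = 0 := by
    refine Z_div (f := fun q => q.2 * V q) (L := L) (by fun_prop) (by fun_prop) ?_ ?_ ?_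
    · intro q hq; simp [hL q hq]
    · intro q hq; simp [hL q hq, hL2 q hq]
    · intro R hR Z
      have := (hasDerivAt_id Z).mul (hV.d2 R hR Z)
      rw [one_mul] at this
      exact this
  have := integral_add (μ := muH) (f := fun q : ℝ × ℝ => V q + q.1 * V1 q)
    (g := fun q : ℝ × ℝ => V q + q.2 * V2 q)
    (int_of_supp (L := L) (by fun_prop) (by intro q hq; simp [hL q hq, hL1 q hq]))
    (int_of_supp (L := L) (by fun_prop) (by intro q hq; simp [hL q hq, hL2 q hq]))
  rw [A, B, add_zero] at this
  rw [← this]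
  congr 1; ext q; ring

lemma shift_int (f : ℝ × ℝ → ℝ) (h : ℝ) :
    ∫ q, f (q.1, q.2 + h) ∂muH = ∫ q, f q ∂muH := by
  have mp : MeasurePreserving (Prod.map id (fun z : ℝ => z + h)) muH muH :=
    (MeasurePreserving.id _).prod (measurePreserving_add_right volume h)
  have := mp.integral_comp
    ((MeasurableEquiv.prodCongr (MeasurableEquiv.refl ℝ)
      (MeasurableEquiv.addRight h)).measurableEmbedding) f
  exact this

lemma norm_shift {L h : ℝ} (h1 : h ≤ 1) {q : ℝ × ℝ} (hq : L + 1 < ‖q‖) (s : ℝ)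
    (hs : |s| ≤ h) : L < ‖((q.1, q.2 + s) : ℝ × ℝ)‖ := by
  rw [Prod.norm_def, Real.norm_eq_abs, Real.norm_eq_abs] at *
  rcases lt_max_iff.1 hq with h | h
  · exact lt_max_of_lt_left (by simp; linarith)
  · apply lt_max_of_lt_right
    have : |q.2| ≤ |q.2 + s| + |s| := by
      have := abs_sub (q.2 + s) s
      simpa using this
    simp only; linarith

lemma green_h {P P1 P2 V V1 V2 : ℝ × ℝ → ℝ} (hP : Good P P1 P2) (hV : Good V V1 V2)
    (hP0 : ∀ Z Z', P (0, Z) = P (0, Z')) {L : ℝ}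
    (hL : ∀ q, L < ‖q‖ → V q = 0) (hL1 : ∀ q, L < ‖q‖ → V1 q = 0) (h : ℝ) (h0 : 0 < h)
    (h1 : h ≤ 1) :
    ∫ q, ((P (q.1, q.2 + h) - P q) / h * V1 q + P1 q * ((V (q.1, q.2 - h) - V q) / h)) ∂muH
      = 0 := by
  have c := hV.c
  have c1 := hV.c1
  have d := hP.c
  have d1 := hP.c1
  have A : ∫ q, ((P1 (q.1, q.2 + h) - P1 q) / h * V q + (P (q.1, q.2 + h) - P q) / h * V1 q)
      ∂muH = 0 := by
    refine R_div (f := fun q => (P (q.1, q.2 + h) - P q) / h * V q) (L := L)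
      (by fun_prop) (by fun_prop) ?_ ?_ ?_ ?_
    · intro q hq; simp [hL q hq]
    · intro q hq; simp [hL q hq, hL1 q hq]
    · intro R hR Z
      exact (((hP.d1 R hR (Z + h)).sub (hP.d1 R hR Z)).div_const h).mul (hV.d1 R hR Z)
    · intro Z; simp [hP0 (Z + h) Z]
  have B := shift_int (fun q => P1 q * V (q.1, q.2 - h)) h
  simp only [add_sub_cancel_right, Prod.mk.eta] at B
  have hVs : ∀ q : ℝ × ℝ, L + 1 < ‖q‖ → V (q.1, q.2 - h) = 0 := by
    intro q hq
    apply hL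
    rw [sub_eq_add_neg]
    exact norm_shift h1 hq (-h) (by rw [abs_neg, abs_of_pos h0])
  have i1 : Integrable (fun q : ℝ × ℝ => P1 (q.1, q.2 + h) * V q) muH :=
    int_of_supp (L := L) (by fun_prop) (by intro q hq; simp [hL q hq])
  have i2 : Integrable (fun q : ℝ × ℝ => P1 q * V (q.1, q.2 - h)) muH :=
    int_of_supp (L := L + 1) (by fun_prop) (by intro q hq; simp [hVs q hq])
  have i3 : Integrable (fun q : ℝ × ℝ =>
      (P1 (q.1, q.2 + h) - P1 q) / h * V q + (P (q.1, q.2 + h) - P q) / h * V1 q) muH :=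
    int_of_supp (L := L) (by fun_prop) (by intro q hq; simp [hL q hq, hL1 q hq])
  have e : (fun q : ℝ × ℝ => (P (q.1, q.2 + h) - P q) / h * V1 q
      + P1 q * ((V (q.1, q.2 - h) - V q) / h)) = fun q : ℝ × ℝ =>
      ((P1 (q.1, q.2 + h) - P1 q) / h * V q + (P (q.1, q.2 + h) - P q) / h * V1 q)
      + (1/h) * (P1 q * V (q.1, q.2 - h) - P1 (q.1, q.2 + h) * V q) := by
    ext q; field_simp; ring
  have i4 : Integrable (fun q : ℝ × ℝ =>
      P1 q * V (q.1, q.2 - h) - P1 (q.1, q.2 + h) * V q) muH := i2.sub i1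
  rw [e, integral_add i3 (i4.const_mul _), A, integral_const_mul, integral_sub i2 i1, B]
  simp

lemma green {P P1 P2 V V1 V2 : ℝ × ℝ → ℝ} (hP : Good P P1 P2) (hV : Good V V1 V2)
    (hP0 : ∀ Z Z', P (0, Z) = P (0, Z')) {L : ℝ}
    (hL : ∀ q, L < ‖q‖ → V q = 0) (hL1 : ∀ q, L < ‖q‖ → V1 q = 0)
    (hL2 : ∀ q, L < ‖q‖ → V2 q = 0) :
    ∫ q, (P2 q * V1 q - P1 q * V2 q) ∂muH = 0 := by
  have c := hV.c
  have c1 := hV.c1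
  have c2 := hV.c2
  have d := hP.c
  have d1 := hP.c1
  have d2 := hP.c2
  set K : Set (ℝ × ℝ) := Metric.closedBall 0 (L + 1) with hK
  have hKc : IsCompact K := isCompact_closedBall _ _
  obtain ⟨M1, hM1⟩ := hKc.exists_bound_of_continuousOn d1.continuousOn
  obtain ⟨M2, hM2⟩ := hKc.exists_bound_of_continuousOn d2.continuousOn
  obtain ⟨N1, hN1⟩ := hKc.exists_bound_of_continuousOn c1.continuousOn
  obtain ⟨N2, hN2⟩ := hKc.exists_bound_of_continuousOn c2.continuousOn
  have memK : ∀ q : ℝ × ℝ, q ∈ K ↔ ‖q‖ ≤ L + 1 := by intro q; simp [hK]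
  set hn : ℕ → ℝ := fun n => 1 / ((n : ℝ) + 1) with hhn
  have hn0 : ∀ n, 0 < hn n := fun n => Nat.one_div_pos_of_nat
  have hn1 : ∀ n, hn n ≤ 1 := by
    intro n
    rw [hhn]
    simp only
    rw [div_le_one (by positivity)]
    have : (0:ℝ) ≤ n := by positivity
    linarith
  have hnt : Tendsto hn atTop (𝓝[≠] 0) := by
    rw [tendsto_nhdsWithin_iff]
    exact ⟨tendsto_one_div_add_atTop_nhds_zero_nat, Eventually.of_forall fun n => (hn0 n).ne'⟩
  have hnt' : Tendsto (fun n => - hn n) atTop (𝓝[≠] 0) := by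
    rw [tendsto_nhdsWithin_iff]
    refine ⟨?_, Eventually.of_forall fun n => (neg_ne_zero.2 (hn0 n).ne')⟩
    have : Tendsto hn atTop (𝓝 0) := tendsto_one_div_add_atTop_nhds_zero_nat
    simpa using this.neg
  have key := tendsto_integral_of_dominated_convergence (μ := muH)
    (F := fun n q => (P (q.1, q.2 + hn n) - P q) / hn n * V1 q
      + P1 q * ((V (q.1, q.2 - hn n) - V q) / hn n))
    (f := fun q => P2 q * V1 q - P1 q * V2 q)
    (K.indicator fun _ => |M2| * |N1| + |M1| * |N2|) ?_ ?_ ?_ ?_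
  · refine tendsto_nhds_unique key ?_
    simp only [fun n => green_h hP hV hP0 hL hL1 (hn n) (hn0 n) (hn1 n)]
    exact tendsto_const_nhds
  · intro n
    exact Continuous.aestronglyMeasurable (by fun_prop)
  · rw [muH_eq]
    refine Integrable.restrict ?_
    rw [integrable_indicator_iff hKc.measurableSet]
    exact continuousOn_const.integrableOn_compact hKc
  · intro n
    filter_upwards [muH_neg] with q hq
    have p0 := hn0 n
    have p1 := hn1 n
    set h := hn n
    by_cases hqK : q ∈ K
    · rw [indicator_of_mem hqK]
      have hqn := (memK q).1 hqK
      have b1 : ‖P1 q‖ ≤ |M1| := (hM1 q hqK).trans (le_abs_self _)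
      have T1 : ‖(P (q.1, q.2 + h) - P q) / h * V1 q‖ ≤ |M2| * |N1| := by
        by_cases hq' : L < ‖q‖
        · rw [hL1 q hq']; simp; positivity
        · push Not at hq'
          obtain ⟨z, hz, hz'⟩ := exists_hasDerivAt_eq_slope (fun s => P (q.1, s))
            (fun s => P2 (q.1, s)) (a := q.2) (b := q.2 + h) (by linarith)
            (by fun_prop : Continuous fun s => P (q.1, s)).continuousOn
            (fun x _ => hP.d2 _ hq x)
          have e : (P (q.1, q.2 + h) - P q) / h = P2 (q.1, z) := by
            rw [hz']; simp
          rw [e, norm_mul]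
          have hzK : (q.1, z) ∈ K := by
            rw [memK]
            rw [Prod.norm_def, Real.norm_eq_abs, Real.norm_eq_abs] at hq' ⊢
            have h2 := (max_le_iff.1 hq')
            refine max_le (by simp only; linarith [h2.1]) ?_
            simp only
            have := abs_le.1 h2.2
            rw [abs_le]; constructor <;> linarith [hz.1, hz.2]
          exact mul_le_mul ((hM2 _ hzK).trans (le_abs_self _)) ((hN1 _ hqK).trans (le_abs_self _))
            (norm_nonneg _) (abs_nonneg _)
      have T2 : ‖P1 q * ((V (q.1, q.2 - h) - V q) / h)‖ ≤ |M1| * |N2| := by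
        obtain ⟨z, hz, hz'⟩ := exists_hasDerivAt_eq_slope (fun s => V (q.1, s))
            (fun s => V2 (q.1, s)) (a := q.2 - h) (b := q.2) (by linarith)
            (by fun_prop : Continuous fun s => V (q.1, s)).continuousOn
            (fun x _ => hV.d2 _ hq x)
        have e : (V (q.1, q.2 - h) - V q) / h = - V2 (q.1, z) := by
          rw [hz']; simp; ring
        rw [e, norm_mul, norm_neg]
        refine mul_le_mul b1 ?_ (norm_nonneg _) (abs_nonneg _)
        by_cases hzK : (q.1, z) ∈ K
        · exact (hN2 _ hzK).trans (le_abs_self _)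
        · rw [memK] at hzK
          rw [hL2 _ (by linarith)]; simp
      exact (norm_add_le _ _).trans (add_le_add T1 T2)
    · rw [indicator_of_notMem hqK]
      rw [memK] at hqK
      push Not at hqK
      rw [hL1 q (by linarith), hL q (by linarith), hL]
      · simp
      · rw [sub_eq_add_neg]
        exact norm_shift p1 hqK (-h) (by rw [abs_neg, abs_of_pos p0])
  · filter_upwards [muH_neg] with q hq
    have t1 := (hP.d2 q.1 hq q.2).tendsto_slope_zero.comp hnt
    have t2 := (hV.d2 q.1 hq q.2).tendsto_slope_zero.comp hnt'
    have := (t1.mul_const (V1 q)).sub (t2.const_mul (P1 q))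
    refine this.congr ?_
    intro n
    simp only [Function.comp, smul_eq_mul, ← sub_eq_add_neg]
    have := (hn0 n).ne'
    field_simp
    ring

lemma Good.mul {f f1 f2 g g1 g2 : ℝ × ℝ → ℝ} (hf : Good f f1 f2) (hg : Good g g1 g2) :
    Good (fun q => f q * g q) (fun q => f1 q * g q + f q * g1 q)
      (fun q => f2 q * g q + f q * g2 q) where
  c := hf.c.mul hg.c
  c1 := (hf.c1.mul hg.c).add (hf.c.mul hg.c1)
  c2 := (hf.c2.mul hg.c).add (hf.c.mul hg.c2)
  d1 := fun R hR Z => (hf.d1 R hR Z).mul (hg.d1 R hR Z)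
  d2 := fun R hR Z => (hf.d2 R hR Z).mul (hg.d2 R hR Z)

lemma Good.pow {f f1 f2 : ℝ × ℝ → ℝ} (hf : Good f f1 f2) (n : ℕ) :
    Good (fun q => f q ^ n) (fun q => n * f q ^ (n - 1) * f1 q)
      (fun q => n * f q ^ (n - 1) * f2 q) where
  c := hf.c.pow n
  c1 := (continuous_const.mul (hf.c.pow _)).mul hf.c1
  c2 := (continuous_const.mul (hf.c.pow _)).mul hf.c2
  d1 := fun R hR Z => (hf.d1 R hR Z).pow n
  d2 := fun R hR Z => (hf.d2 R hR Z).pow n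

lemma good_of_contDiffOn (F : ℝ → ℝ → ℝ)
    (h : ContDiffOn ℝ 1 (fun q : ℝ × ℝ => F q.1 q.2) {q : ℝ × ℝ | q.1 ≤ 0}) :
    ∃ f f1 f2, Good f f1 f2 ∧ (∀ R ≤ 0, ∀ Z, f (R, Z) = F R Z) ∧
      (∀ R < 0, ∀ Z, pd1 F R Z = f1 (R, Z)) ∧ (∀ R < 0, ∀ Z, pd2 F R Z = f2 (R, Z)) := by
  set S : Set (ℝ × ℝ) := {q : ℝ × ℝ | q.1 ≤ 0} with hS
  set G : ℝ × ℝ → ℝ := fun q => F q.1 q.2 with hG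
  have hSe : S = Iic 0 ×ˢ univ := by ext q; simp [hS]
  have hu : UniqueDiffOn ℝ S := by
    rw [hSe]; exact (uniqueDiffOn_Iic 0).prod uniqueDiffOn_univ
  have hc' : ContinuousOn (fderivWithin ℝ G S) S := h.continuousOn_fderivWithin hu le_rfl
  have hπ : Continuous fun q : ℝ × ℝ => (min q.1 0, q.2) := by fun_prop
  have hπS : ∀ q : ℝ × ℝ, (min q.1 0, q.2) ∈ S := fun q => min_le_right q.1 0
  have hder : ∀ R < 0, ∀ Z, HasFDerivAt G (fderivWithin ℝ G S (R, Z)) (R, Z) := by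
    intro R hR Z
    have hmem : S ∈ 𝓝 (R, Z) := by
      have : Iio (0:ℝ) ×ˢ (univ : Set ℝ) ∈ 𝓝 (R, Z) :=
        (isOpen_Iio.prod isOpen_univ).mem_nhds ⟨hR, trivial⟩
      refine mem_of_superset this ?_
      intro q hq
      exact (mem_Iio.1 hq.1).le
    exact ((h.differentiableOn one_ne_zero (R, Z) (le_of_lt hR)).hasFDerivWithinAt).hasFDerivAt hmem
  have D1 : ∀ R < 0, ∀ Z, HasDerivAt (fun s => F s Z) (fderivWithin ℝ G S (R, Z) (1, 0)) R := by
    intro R hR Z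
    exact (hder R hR Z).comp_hasDerivAt (f := fun s : ℝ => (s, Z)) R
      ((hasDerivAt_id R).prodMk (hasDerivAt_const R Z))
  have D2 : ∀ R < 0, ∀ Z, HasDerivAt (fun s => F R s) (fderivWithin ℝ G S (R, Z) (0, 1)) Z := by
    intro R hR Z
    exact (hder R hR Z).comp_hasDerivAt (f := fun s : ℝ => (R, s)) Z
      ((hasDerivAt_const Z R).prodMk (hasDerivAt_id Z))
  have hfc : Continuous fun q : ℝ × ℝ => fderivWithin ℝ G S (min q.1 0, q.2) :=
    hc'.comp_continuous hπ hπS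
  refine ⟨fun q => G (min q.1 0, q.2), fun q => fderivWithin ℝ G S (min q.1 0, q.2) (1, 0),
    fun q => fderivWithin ℝ G S (min q.1 0, q.2) (0, 1), ⟨?_, ?_, ?_, ?_, ?_⟩, ?_, ?_, ?_⟩
  · exact h.continuousOn.comp_continuous hπ hπS
  · exact hfc.clm_apply continuous_const
  · exact hfc.clm_apply continuous_const
  · intro R hR Z
    simp only [min_eq_left hR.le]
    refine (D1 R hR Z).congr_of_eventuallyEq ?_
    filter_upwards [Iio_mem_nhds hR] with s hs
    simp [hG, min_eq_left (mem_Iio.1 hs).le]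
  · intro R hR Z
    simp only [min_eq_left hR.le]
    exact D2 R hR Z
  · intro R hR Z
    simp [hG, min_eq_left hR]
  · intro R hR Z
    simp only [min_eq_left hR.le]
    exact (D1 R hR Z).deriv
  · intro R hR Z
    simp only [min_eq_left hR.le]
    exact (D2 R hR Z).deriv

lemma boundary_const (F : ℝ → ℝ → ℝ)
    (h : ContDiffOn ℝ 1 (fun q : ℝ × ℝ => F q.1 q.2) {q : ℝ × ℝ | q.1 ≤ 0})
    (hbc : ∀ Z : ℝ, pd2 F 0 Z = 0) (Z Z' : ℝ) : F 0 Z = F 0 Z' := by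
  refine is_const_of_deriv_eq_zero (f := fun s => F 0 s) ?_ hbc Z Z'
  have h1 := h.differentiableOn one_ne_zero
  have h2 : Differentiable ℝ fun s : ℝ => ((0:ℝ), s) := by fun_prop
  have h3 := h1.comp (h2.differentiableOn (s := univ)) (fun s _ => by simp)
  exact differentiableOn_univ.1 h3

lemma trans_deriv : ∃ C, 0 ≤ C ∧ (∀ x, |deriv Real.smoothTransition x| ≤ C) ∧
    (∀ x ≤ 0, deriv Real.smoothTransition x = 0) ∧
    (∀ x ≥ 1, deriv Real.smoothTransition x = 0) := by
  have hc : Continuous (deriv Real.smoothTransition) :=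
    (Real.smoothTransition.contDiff (n := 1)).continuous_deriv le_rfl
  have h0 : ∀ x ≤ 0, deriv Real.smoothTransition x = 0 := by
    have : EqOn (deriv Real.smoothTransition) (fun _ => 0) (Iio 0) := by
      intro x hx
      have : Real.smoothTransition =ᶠ[𝓝 x] fun _ => 0 := by
        filter_upwards [Iio_mem_nhds hx] with y hy
        exact Real.smoothTransition.zero_of_nonpos (le_of_lt hy)
      rw [this.deriv_eq]; simp
    have := this.closure hc continuous_const
    rw [closure_Iio] at this
    exact fun x hx => this hx
  have h1 : ∀ x ≥ 1, deriv Real.smoothTransition x = 0 := by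
    have : EqOn (deriv Real.smoothTransition) (fun _ => 0) (Ioi 1) := by
      intro x hx
      have : Real.smoothTransition =ᶠ[𝓝 x] fun _ => 1 := by
        filter_upwards [Ioi_mem_nhds hx] with y hy
        exact Real.smoothTransition.one_of_one_le (le_of_lt hy)
      rw [this.deriv_eq]; simp
    have := this.closure hc continuous_const
    rw [closure_Ioi] at this
    exact fun x hx => this hx
  obtain ⟨C, hC⟩ := (isCompact_Icc (a := (0:ℝ)) (b := 1)).exists_bound_of_continuousOn
    hc.continuousOn
  refine ⟨|C|, abs_nonneg _, ?_, h0, h1⟩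
  intro x
  rcases le_total x 0 with hx | hx
  · rw [h0 x hx]; simp
  rcases le_total 1 x with hx' | hx'
  · rw [h1 x hx']; simp
  exact (hC x ⟨hx, hx'⟩).trans (le_abs_self _)

noncomputable def cArg (ρ : ℝ) (q : ℝ × ℝ) : ℝ := (4 - (q.1 ^ 2 + q.2 ^ 2) / ρ ^ 2) / 3

noncomputable def cut (ρ : ℝ) (q : ℝ × ℝ) : ℝ := Real.smoothTransition (cArg ρ q)

noncomputable def cut' (ρ : ℝ) (q : ℝ × ℝ) : ℝ :=
  deriv Real.smoothTransition (cArg ρ q) * (-(2 / (3 * ρ ^ 2)))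

lemma cArg_cont (ρ : ℝ) : Continuous (cArg ρ) := by
  unfold cArg; fun_prop

lemma cut_good (ρ : ℝ) :
    Good (cut ρ) (fun q => cut' ρ q * q.1) (fun q => cut' ρ q * q.2) := by
  have hc : Continuous (deriv Real.smoothTransition) :=
    (Real.smoothTransition.contDiff (n := 1)).continuous_deriv le_rfl
  have hc' : Continuous (cut' ρ) := (hc.comp (cArg_cont ρ)).mul continuous_const
  have hd : ∀ x, HasDerivAt Real.smoothTransition (deriv Real.smoothTransition x) x :=
    fun x => ((Real.smoothTransition.contDiff (n := 1)).differentiable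
      one_ne_zero x).hasDerivAt
  refine ⟨Real.smoothTransition.continuous.comp (cArg_cont ρ), by fun_prop, by fun_prop, ?_, ?_⟩
  · intro R _ Z
    have h1 : HasDerivAt (fun s => cArg ρ (s, Z)) (-(2 / (3 * ρ ^ 2)) * R) R := by
      have := (((((hasDerivAt_id R).pow 2).add_const (Z ^ 2)).div_const (ρ ^ 2)).const_sub 4).div_const 3
      refine this.congr_deriv ?_
      simp only [id]; field_simp; ring
    have := (hd (cArg ρ (R, Z))).comp R h1
    refine this.congr_deriv ?_
    simp only [cut']; ring
  · intro R _ Z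
    have h1 : HasDerivAt (fun s => cArg ρ (R, s)) (-(2 / (3 * ρ ^ 2)) * Z) Z := by
      have := (((((hasDerivAt_id Z).pow 2).const_add (R ^ 2)).div_const (ρ ^ 2)).const_sub 4).div_const 3
      refine this.congr_deriv ?_
      simp only [id]; field_simp; ring
    have := (hd (cArg ρ (R, Z))).comp Z h1
    refine this.congr_deriv ?_
    simp only [cut']; ring

lemma cArg_nonpos {ρ : ℝ} (hρ : 0 < ρ) {q : ℝ × ℝ} (h : 4 * ρ ^ 2 ≤ q.1 ^ 2 + q.2 ^ 2) :
    cArg ρ q ≤ 0 := by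
  unfold cArg
  have : 4 ≤ (q.1 ^ 2 + q.2 ^ 2) / ρ ^ 2 := by rw [le_div_iff₀ (by positivity)]; exact h
  linarith

lemma cArg_ge {ρ : ℝ} (hρ : 0 < ρ) {q : ℝ × ℝ} (h : q.1 ^ 2 + q.2 ^ 2 ≤ ρ ^ 2) :
    1 ≤ cArg ρ q := by
  unfold cArg
  have : (q.1 ^ 2 + q.2 ^ 2) / ρ ^ 2 ≤ 1 := by rw [div_le_one (by positivity)]; exact h
  linarith

lemma sq_of_norm {ρ : ℝ} (hρ : 0 < ρ) {q : ℝ × ℝ} (h : 2 * ρ < ‖q‖) :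
    4 * ρ ^ 2 ≤ q.1 ^ 2 + q.2 ^ 2 := by
  rw [Prod.norm_def, Real.norm_eq_abs, Real.norm_eq_abs] at h
  rcases lt_max_iff.1 h with h | h
  · nlinarith [sq_abs q.1, sq_nonneg q.2]
  · nlinarith [sq_abs q.2, sq_nonneg q.1]

/-- the weak form of the transport equation -/
lemma weak_form {γ : ℝ} {P P1 P2 W W1 W2 φ φ1 φ2 : ℝ × ℝ → ℝ} (hP : Good P P1 P2)
    (hW : Good W W1 W2) (hφ : Good φ φ1 φ2) (hP0 : ∀ Z Z', P (0, Z) = P (0, Z')) {L : ℝ}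
    (hL : ∀ q, L < ‖q‖ → φ q = 0) (hL1 : ∀ q, L < ‖q‖ → φ1 q = 0)
    (hL2 : ∀ q, L < ‖q‖ → φ2 q = 0)
    (hpde : ∀ R < 0, ∀ Z, (γ * R - P2 (R, Z)) * W1 (R, Z) + (γ * Z + P1 (R, Z)) * W2 (R, Z) = 0) :
    2 * γ * ∫ q, W q * φ q ∂muH =
      ∫ q, -(W q * ((γ * q.1 - P2 q) * φ1 q + (γ * q.2 + P1 q) * φ2 q)) ∂muH := by
  have hV := hW.mul hφ
  have s0 : ∀ q, L < ‖q‖ → W q * φ q = 0 := by intro q hq; simp [hL q hq]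
  have s1 : ∀ q, L < ‖q‖ → W1 q * φ q + W q * φ1 q = 0 := by
    intro q hq; simp [hL q hq, hL1 q hq]
  have s2 : ∀ q, L < ‖q‖ → W2 q * φ q + W q * φ2 q = 0 := by
    intro q hq; simp [hL q hq, hL2 q hq]
  have E := euler hV s0 s1 s2
  have G := green hP hV hP0 s0 s1 s2
  obtain ⟨pc, pc1, pc2, -, -⟩ := hP
  obtain ⟨wc, wc1, wc2, -, -⟩ := hW
  obtain ⟨fc, fc1, fc2, -, -⟩ := hφ
  have iV : Integrable (fun q => W q * φ q) muH := int_of_supp (L := L) (by fun_prop) s0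
  have iE : Integrable (fun q : ℝ × ℝ => q.1 * (W1 q * φ q + W q * φ1 q)
      + q.2 * (W2 q * φ q + W q * φ2 q) + 2 * (W q * φ q)) muH :=
    int_of_supp (L := L) (by fun_prop) (by intro q hq; rw [s0 q hq, s1 q hq, s2 q hq]; simp)
  have iG : Integrable (fun q : ℝ × ℝ => P2 q * (W1 q * φ q + W q * φ1 q)
      - P1 q * (W2 q * φ q + W q * φ2 q)) muH :=
    int_of_supp (L := L) (by fun_prop) (by intro q hq; rw [s1 q hq, s2 q hq]; simp)
  have e : ∫ q, -(W q * ((γ * q.1 - P2 q) * φ1 q + (γ * q.2 + P1 q) * φ2 q)) ∂muH =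
      ∫ q, ((2 * γ) * (W q * φ q) - (γ * (q.1 * (W1 q * φ q + W q * φ1 q)
      + q.2 * (W2 q * φ q + W q * φ2 q) + 2 * (W q * φ q)) - (P2 q * (W1 q * φ q + W q * φ1 q)
      - P1 q * (W2 q * φ q + W q * φ2 q)))) ∂muH := by
    refine integral_congr_ae ?_
    filter_upwards [muH_neg] with q hq
    have := hpde q.1 hq q.2
    simp only [Prod.mk.eta] at this
    linear_combination (φ q) * this
  have iEG : Integrable (fun q : ℝ × ℝ => γ * (q.1 * (W1 q * φ q + W q * φ1 q)
      + q.2 * (W2 q * φ q + W q * φ2 q) + 2 * (W q * φ q)) - (P2 q * (W1 q * φ q + W q * φ1 q)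
      - P1 q * (W2 q * φ q + W q * φ2 q))) muH := (iE.const_mul γ).sub iG
  rw [e, integral_sub (iV.const_mul _) iEG, integral_sub (iE.const_mul _) iG,
    integral_const_mul, integral_const_mul, E, G]
  simp

end

/-- **Integral rigidity for the degenerate transport equation on the half-plane.**
On `𝒟 = {(R,Z) : R ≤ 0}`, with `γ > 0` and `p` a positive even integer, let `U, Ψ` be
`C¹` up to the boundary with `U` bounded.  If `(γ Y + ∇^⊥Ψ)·∇U = 0` on `𝒟`,
`∂_Z Ψ(0,Z) = 0` for all `Z`, `|∇Ψ(Y)|/|Y| → 0` as `|Y| → ∞` in `𝒟`, and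
`∫_{Y ∈ 𝒟, ρ < |Y| < 2ρ} U(Y)^p dY → 0` as `ρ → ∞` (2D Lebesgue measure), then
`U ≡ 0` on `𝒟`. -/
theorem integral_rigidity_degenerate_transport
    (γ : ℝ) (hγ : 0 < γ) (p : ℕ) (hp : 0 < p) (hpeven : Even p)
    (U Ψ : ℝ → ℝ → ℝ)
    (hU : ContDiffOn ℝ 1 (fun q : ℝ × ℝ => U q.1 q.2) {q : ℝ × ℝ | q.1 ≤ 0})
    (hΨ : ContDiffOn ℝ 1 (fun q : ℝ × ℝ => Ψ q.1 q.2) {q : ℝ × ℝ | q.1 ≤ 0})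
    (hUbdd : ∃ C : ℝ, ∀ R ≤ (0 : ℝ), ∀ Z : ℝ, |U R Z| ≤ C)
    (hpde : ∀ R ≤ (0 : ℝ), ∀ Z : ℝ,
      (γ * R - pd2 Ψ R Z) * pd1 U R Z + (γ * Z + pd1 Ψ R Z) * pd2 U R Z = 0)
    (hbc : ∀ Z : ℝ, pd2 Ψ 0 Z = 0)
    (hgrad : ∀ ε > 0, ∃ M : ℝ, ∀ R ≤ (0 : ℝ), ∀ Z : ℝ,
      M < Real.sqrt (R ^ 2 + Z ^ 2) →
      Real.sqrt ((pd1 Ψ R Z) ^ 2 + (pd2 Ψ R Z) ^ 2) ≤ ε * Real.sqrt (R ^ 2 + Z ^ 2))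
    (hint : Tendsto (fun ρ : ℝ =>
      ∫ q in {q : ℝ × ℝ | q.1 ≤ 0 ∧ ρ < Real.sqrt (q.1 ^ 2 + q.2 ^ 2)
                ∧ Real.sqrt (q.1 ^ 2 + q.2 ^ 2) < 2 * ρ}, (U q.1 q.2) ^ p)
      atTop (nhds 0)) :
    ∀ R ≤ (0 : ℝ), ∀ Z : ℝ, U R Z = 0 := by
  classical
  obtain ⟨u, u1, u2, hu, huU, hu1, hu2⟩ := good_of_contDiffOn U hU
  obtain ⟨P, P1, P2, hP, hPΨ, hP1, hP2⟩ := good_of_contDiffOn Ψ hΨ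
  have hP0 : ∀ Z Z', P (0, Z) = P (0, Z') := by
    intro Z Z'
    rw [hPΨ 0 le_rfl, hPΨ 0 le_rfl]
    exact boundary_const Ψ hΨ hbc Z Z'
  have hW := hu.pow p
  have hWc := hW.c
  have hW0 : ∀ q, 0 ≤ u q ^ p := fun q => hpeven.pow_nonneg _
  have hpde' : ∀ R < 0, ∀ Z, (γ * R - P2 (R, Z)) * ((p : ℝ) * u (R, Z) ^ (p - 1) * u1 (R, Z))
      + (γ * Z + P1 (R, Z)) * ((p : ℝ) * u (R, Z) ^ (p - 1) * u2 (R, Z)) = 0 := by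
    intro R hR Z
    have := hpde R hR.le Z
    rw [hu1 R hR, hu2 R hR, hP1 R hR, hP2 R hR] at this
    linear_combination ((p : ℝ) * u (R, Z) ^ (p - 1)) * this
  obtain ⟨C, hC0, hC, hCl, hCr⟩ := trans_deriv
  obtain ⟨M, hM⟩ := hgrad 1 one_pos
  have cutL : ∀ ρ > 0, ∀ q : ℝ × ℝ, 2 * ρ < ‖q‖ → cut ρ q = 0 := fun ρ hρ q hq =>
    Real.smoothTransition.zero_of_nonpos (cArg_nonpos hρ (sq_of_norm hρ hq))
  have cutL' : ∀ ρ > 0, ∀ q : ℝ × ℝ, 2 * ρ < ‖q‖ → cut' ρ q = 0 := fun ρ hρ q hq => by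
    simp [cut', hCl _ (cArg_nonpos hρ (sq_of_norm hρ hq))]
  have iJ : ∀ ρ > 0, Integrable (fun q => u q ^ p * cut ρ q) muH := fun ρ hρ =>
    int_of_supp (L := 2 * ρ) (hWc.mul (cut_good ρ).c) (by intro q hq; simp [cutL ρ hρ q hq])
  let A : ℝ → Set (ℝ × ℝ) := fun ρ => {q : ℝ × ℝ | q.1 ≤ 0 ∧ ρ < Real.sqrt (q.1 ^ 2 + q.2 ^ 2)
                ∧ Real.sqrt (q.1 ^ 2 + q.2 ^ 2) < 2 * ρ}
  have hAm : ∀ ρ, MeasurableSet (A ρ) := by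
    intro ρ
    have m1 : Measurable fun q : ℝ × ℝ => Real.sqrt (q.1 ^ 2 + q.2 ^ 2) := by fun_prop
    exact (measurableSet_le measurable_fst measurable_const).inter
      ((measurableSet_lt measurable_const m1).inter (measurableSet_lt m1 measurable_const))
  have hAi : ∀ ρ > 0, Integrable ((A ρ).indicator fun q => u q ^ p) := by
    intro ρ hρ
    rw [integrable_indicator_iff (hAm ρ)]
    refine (hWc.continuousOn.integrableOn_compact
      (isCompact_closedBall (0 : ℝ × ℝ) (2 * ρ))).mono_set ?_
    intro q hq
    rw [mem_closedBall_zero_iff]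
    by_contra hcon
    push Not at hcon
    have h1 := sq_of_norm hρ hcon
    have h2 := (Real.sqrt_lt' (by positivity)).1 hq.2.2
    linarith
  set K : ℝ := C * (8 / 3) * (γ + 1) with hK
  have hK0 : 0 ≤ K := by positivity
  have est : ∀ ρ > 0, M < ρ → 2 * γ * ∫ q, u q ^ p * cut ρ q ∂muH ≤
      K * ∫ q in A ρ, (U q.1 q.2) ^ p := by
    intro ρ hρ hρM
    have cL := cutL ρ hρ
    have cL' := cutL' ρ hρ
    rw [weak_form (γ := γ) hP hW (cut_good ρ) hP0 (L := 2 * ρ) cL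
      (by intro q hq; simp [cL' q hq]) (by intro q hq; simp [cL' q hq]) hpde']
    have e : ∫ q in A ρ, (U q.1 q.2) ^ p = ∫ q, (A ρ).indicator (fun q => u q ^ p) q := by
      rw [integral_indicator (hAm ρ)]
      refine setIntegral_congr_fun (hAm ρ) ?_
      intro q hq
      have : u q = U q.1 q.2 := huU q.1 hq.1 q.2
      simp [this]
    have ineq1 : ∫ q, (A ρ).indicator (fun q => u q ^ p) q ∂muH ≤
        ∫ q, (A ρ).indicator (fun q => u q ^ p) q := by
      rw [muH_eq]
      refine setIntegral_le_integral (hAi ρ hρ) (Eventually.of_forall fun q => ?_)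
      exact Set.indicator_nonneg (fun q _ => hW0 q) q
    rw [e]
    refine le_trans ?_ (mul_le_mul_of_nonneg_left ineq1 hK0)
    rw [← integral_const_mul]
    have cg := cut_good ρ
    refine integral_mono_ae ?_ ?_ ?_
    · have := hP.c1
      have := hP.c2
      have := cg.c1
      have := cg.c2
      refine int_of_supp (L := 2 * ρ) (by fun_prop) ?_
      intro q hq; simp [cL' q hq]
    · refine Integrable.const_mul ?_ K
      rw [muH_eq]
      exact (hAi ρ hρ).restrict
    · filter_upwards [muH_neg] with q hq
      by_cases hqA : q ∈ A ρ
      · rw [Set.indicator_of_mem hqA]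
        obtain ⟨-, hq1, hq2⟩ := hqA
        have hg := hM q.1 hq.le q.2 (hρM.trans hq1)
        rw [hP1 _ hq, hP2 _ hq, Prod.mk.eta] at hg
        have r2 := (Real.sqrt_lt' (by positivity)).1 hq2
        have hs : (0:ℝ) ≤ q.1 ^ 2 + q.2 ^ 2 := by positivity
        rw [one_mul, Real.sqrt_le_sqrt_iff hs] at hg
        have hb : |γ * (q.1 ^ 2 + q.2 ^ 2) - q.1 * P2 q + q.2 * P1 q| ≤ (γ + 1) * (4 * ρ ^ 2) := by
          have hb1 : |q.2 * P1 q - q.1 * P2 q| ≤ q.1 ^ 2 + q.2 ^ 2 := by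
            rw [abs_le]
            constructor
            · nlinarith [sq_nonneg (q.2 + P1 q), sq_nonneg (q.1 - P2 q)]
            · nlinarith [sq_nonneg (q.2 - P1 q), sq_nonneg (q.1 + P2 q)]
          rw [abs_le] at hb1 ⊢
          have : (γ + 1) * (q.1 ^ 2 + q.2 ^ 2) ≤ (γ + 1) * (4 * ρ ^ 2) :=
            mul_le_mul_of_nonneg_left (by linarith) (by linarith)
          have : 0 ≤ γ * (q.1 ^ 2 + q.2 ^ 2) := by positivity
          constructor <;> linarith
        have hd : |(γ * q.1 - P2 q) * (cut' ρ q * q.1) + (γ * q.2 + P1 q) * (cut' ρ q * q.2)|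
            ≤ K := by
          have e1 : (γ * q.1 - P2 q) * (cut' ρ q * q.1) + (γ * q.2 + P1 q) * (cut' ρ q * q.2)
            = deriv Real.smoothTransition (cArg ρ q) * ((-(2 / (3 * ρ ^ 2))) *
              (γ * (q.1 ^ 2 + q.2 ^ 2) - q.1 * P2 q + q.2 * P1 q)) := by
            unfold cut'; ring
          rw [e1, abs_mul, abs_mul, abs_neg, abs_of_pos (show 0 < 2 / (3 * ρ ^ 2) by positivity)]
          calc _ ≤ C * (2 / (3 * ρ ^ 2) * ((γ + 1) * (4 * ρ ^ 2))) := by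
                refine mul_le_mul (hC _) ?_ (by positivity) hC0
                exact mul_le_mul_of_nonneg_left hb (by positivity)
            _ = K := by rw [hK]; field_simp; ring
        have := neg_abs_le ((γ * q.1 - P2 q) * (cut' ρ q * q.1) + (γ * q.2 + P1 q) * (cut' ρ q * q.2))
        nlinarith [hW0 q]
      · rw [Set.indicator_of_notMem hqA]
        have hz : cut' ρ q = 0 := by
          unfold cut'
          rcases le_or_gt (q.1 ^ 2 + q.2 ^ 2) (ρ ^ 2) with h | h
          · rw [hCr _ (cArg_ge hρ h), zero_mul]
          rcases le_or_gt (4 * ρ ^ 2) (q.1 ^ 2 + q.2 ^ 2) with h' | h'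
          · rw [hCl _ (cArg_nonpos hρ h'), zero_mul]
          exfalso
          refine hqA ⟨hq.le, ?_, ?_⟩
          · exact (Real.lt_sqrt hρ.le).2 h
          · rw [Real.sqrt_lt' (by positivity)]; linarith
        simp [hz]
  intro R0 hR0 Z0
  set ρ0 : ℝ := 1 + |R0| + |Z0| with hρ0
  have hρ0p : 0 < ρ0 := by positivity
  have hJ0 : ∫ q, u q ^ p * cut ρ0 q ∂muH ≤ 0 := by
    have lim : Tendsto (fun ρ => K * ∫ q in A ρ, (U q.1 q.2) ^ p) atTop (nhds 0) := by
      simpa using hint.const_mul K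
    have : 2 * γ * ∫ q, u q ^ p * cut ρ0 q ∂muH ≤ 0 := by
      refine ge_of_tendsto lim ?_
      filter_upwards [eventually_gt_atTop M, eventually_ge_atTop ρ0] with ρ h1 h2
      refine le_trans ?_ (est ρ (hρ0p.trans_le h2) h1)
      refine mul_le_mul_of_nonneg_left ?_ (by positivity)
      refine integral_mono (iJ ρ0 hρ0p) (iJ ρ (hρ0p.trans_le h2)) ?_
      intro q
      refine mul_le_mul_of_nonneg_left ?_ (hW0 q)
      refine Real.smoothTransition.monotone ?_
      unfold cArg
      gcongr
    by_contra hcon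
    push Not at hcon
    have : 0 < 2 * γ * ∫ q, u q ^ p * cut ρ0 q ∂muH := by positivity
    linarith
  have hnn : ∀ q, 0 ≤ u q ^ p * cut ρ0 q :=
    fun q => mul_nonneg (hW0 q) (Real.smoothTransition.nonneg _)
  have hJ1 : ∫ q, u q ^ p * cut ρ0 q ∂muH = 0 :=
    le_antisymm hJ0 (integral_nonneg hnn)
  rw [integral_eq_zero_iff_of_nonneg hnn (iJ ρ0 hρ0p), muH_eq] at hJ1
  have hcont : Continuous fun q => u q ^ p * cut ρ0 q := hWc.mul (cut_good ρ0).c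
  have hE := Measure.eqOn_open_of_ae_eq hJ1 (isOpen_Iio.prod isOpen_univ) hcont.continuousOn
    continuousOn_const
  have hE' := hE.closure hcont continuous_const
  rw [closure_prod_eq, closure_Iio, closure_univ] at hE'
  have hz : u (R0, Z0) ^ p * cut ρ0 (R0, Z0) = 0 := hE' ⟨hR0, trivial⟩
  have hone : cut ρ0 (R0, Z0) = 1 := by
    refine Real.smoothTransition.one_of_one_le (cArg_ge hρ0p ?_)
    simp only
    rw [← sq_abs R0, ← sq_abs Z0, hρ0]
    nlinarith [abs_nonneg R0, abs_nonneg Z0, mul_nonneg (abs_nonneg R0) (abs_nonneg Z0)]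
  rw [hone, mul_one, huU R0 hR0] at hz
  exact pow_eq_zero_iff hp.ne' |>.1 hz
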